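/- arXiv:1611.06500 — 2 statements merged into one kernel-verified Lean document; each statement's English description precedes it below -/
import Mathlib

section
/- There exists a constant C > 0 such that the following holds. Let G = (V,E) be a connected undirected graph on n ≥ 2 vertices, let ε ∈ (0,1), let k = 48·(log n)/ε², and let each edge e of G be assigned an independent weight p_e uniformly distributed on [0,1]. For a real p > 0, let G(p) denote the subgraph of G consisting of all edges of weight at most p. If p ≥ k/(4·λ(G)), then with probability at least 1 − C/n⁴ one has (1−ε)·min(p,1)·λ(G) ≤ λ(G(p)) ≤ (1+ε)·min(p,1)·λ(G), so that λ(G(p))/min(p,1) is a (1+O(ε))-approximation to the edge connectivity λ(G). -/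
open MeasureTheory

/-- The size of the edge cut `E_G(S, V∖S)`: the number of edges of `G` with one
endpoint in `S` and the other in `Sᶜ`. -/
noncomputable def cutSize {V : Type*} (G : SimpleGraph V) (S : Set V) : ℕ :=
  {e ∈ G.edgeSet | ∃ u ∈ S, ∃ v ∈ Sᶜ, e = s(u, v)}.ncard

/-- The edge connectivity of `G`: the minimum of `λ(S,G)` over all nonempty proper
subsets `S ⊂ V`. -/
noncomputable def edgeConn {V : Type*} (G : SimpleGraph V) : ℕ :=
  sInf {c : ℕ | ∃ S : Set V, S.Nonempty ∧ Sᶜ.Nonempty ∧ cutSize G S = c}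

/-- The product over all potential edges of the uniform probability measure on `[0,1]`:
the law of i.i.d. uniform labels `ω e ∈ [0,1]`, one per unordered pair of vertices.
Thresholding these labels at `p` realizes the inclusion of each edge independently with
probability `p`. -/
noncomputable def edgeLabelMeasure (V : Type) [Fintype V] [DecidableEq V] :
    Measure (Sym2 V → ℝ) :=
  Measure.pi fun _ => volume.restrict (Set.Icc 0 1)

/-- The random subgraph `G(p)` of `G` determined by the labels `ω`: an edge `e` of `G`
is included exactly when `ω e ≤ p`, which happens with probability `p` independently
over the edges. -/
def sampledGraph {V : Type} (G : SimpleGraph V) (ω : Sym2 V → ℝ) (p : ℝ) :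
    SimpleGraph V :=
  SimpleGraph.fromEdgeSet {e | e ∈ G.edgeSet ∧ ω e ≤ p}

section Contraction

variable {ι V : Type} [Fintype ι]

/-- The number of edges of the multigraph with edges `a i — b i` joining vertices of
different colours in the colouring `S`. -/
def crossings (a b : ι → V) (S : V → Bool) : ℕ :=
  (Finset.univ.filter fun i => S (a i) ≠ S (b i)).card

/-- The map identifying the vertex `y` with the vertex `x`. -/
def mergeInto [DecidableEq V] {x y : V} (h : x ≠ y) (v : V) : {v : V // v ≠ y} :=
  if hv : v = y then ⟨x, h⟩ else ⟨v, hv⟩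

theorem mergeInto_coe [DecidableEq V] {x y : V} (h : x ≠ y) (v : {v : V // v ≠ y}) :
    mergeInto h v = v := by
  simp [mergeInto, v.2]

/-- Colourings that agree on `x` and `y` are the colourings of the graph with `x` and `y`
identified. -/
theorem sum_filter_eq_sum_mergeInto [Fintype V] [DecidableEq V] {x y : V} (h : x ≠ y)
    (F : (V → Bool) → ℝ) :
    ∑ S : V → Bool with S x = S y, F S =
      ∑ T : {v : V // v ≠ y} → Bool, F (T ∘ mergeInto h) := by
  symm
  refine Finset.sum_bij' (fun T _ => T ∘ mergeInto h) (fun S _ v => S v) ?_ ?_ ?_ ?_ ?_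
  · intro T _
    simp [mergeInto, h]
  · simp
  · intro T _
    funext v
    simp [mergeInto_coe]
  · intro S hS
    have hS : S x = S y := by simpa using hS
    funext v
    by_cases hv : v = y
    · simp [mergeInto, hv, hS]
    · simp [mergeInto, hv]
  · simp

theorem card_filter_eq_add_crossings [DecidableEq V] (a b : ι → V) (S : V → Bool) :
    ((Finset.univ.filter fun i => a i ≠ b i).filter fun i => S (a i) = S (b i)).card +
      crossings a b S = (Finset.univ.filter fun i => a i ≠ b i).card := by
  rw [← Finset.card_filter_add_card_filter_not (s := Finset.univ.filter fun i => a i ≠ b i)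
    (fun i => S (a i) = S (b i)), crossings]
  congr 2
  ext i
  simp only [Finset.mem_filter, Finset.mem_univ, true_and]
  grind

theorem sum_crossings_singleton [Fintype V] [DecidableEq V] (a b : ι → V) :
    ∑ v, crossings a b (fun u => decide (u = v)) =
      2 * (Finset.univ.filter fun i => a i ≠ b i).card := by
  simp only [crossings, Finset.card_filter]
  rw [Finset.sum_comm, Finset.mul_sum]
  refine Finset.sum_congr rfl fun i _ => ?_
  by_cases h : a i = b i
  · simp [h]
  · rw [← Finset.card_filter]
    have : (Finset.univ.filter fun v => decide (a i = v) ≠ decide (b i = v)) = {a i, b i} := by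
      ext v
      simp only [Finset.mem_filter, Finset.mem_univ, true_and, Finset.mem_insert,
        Finset.mem_singleton]
      grind
    rw [this, Finset.card_pair h]
    simp [h]

/-- If every nontrivial cut of a multigraph on `m + 1` vertices has at least `c` edges, its cut
generating function is at most that of the cycle with edges of multiplicity `c / 2`. -/
theorem sum_exp_neg_crossings_le {c : ℝ} (m : ℕ) :
    ∀ (V : Type) [Fintype V] [DecidableEq V] (a b : ι → V), Fintype.card V = m + 1 →
      (∀ S : V → Bool, (∃ u v, S u ≠ S v) → c ≤ crossings a b S) → ∀ t : ℝ, 0 ≤ t →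
      ∑ S : V → Bool, Real.exp (-(t * crossings a b S)) ≤
        (1 + Real.exp (-(c * t / 2))) ^ (m + 1) + (1 - Real.exp (-(c * t / 2))) ^ (m + 1) := by
  induction m with
  | zero =>
    intro V _ _ a b hV _ t _
    have hs : Subsingleton V := Fintype.card_le_one_iff_subsingleton.1 (by omega)
    have h0 : ∀ S : V → Bool, crossings a b S = 0 := fun S => by
      simp [crossings, fun i => Subsingleton.elim (a i) (b i)]
    simp [h0, hV]
    norm_num
  | succ m ih =>
    intro V _ _ a b hV hcut
    set N := Finset.univ.filter fun i => a i ≠ b i with hN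
    set q : ℝ → ℝ := fun t => Real.exp (-(c * t / 2)) with hq
    set f : ℝ → ℝ := fun t => ∑ S : V → Bool, Real.exp (-(t * crossings a b S)) with hf
    set g : ℕ → ℝ → ℝ := fun k t => (1 + q t) ^ k + (1 - q t) ^ k with hg
    have hq0 : ∀ t, 0 < q t := fun t => Real.exp_pos _
    have hdq : ∀ t, HasDerivAt q (-(c / 2) * q t) t := fun t => by
      have : HasDerivAt (fun t : ℝ => -(c * t / 2)) (-(c / 2)) t :=
        (((hasDerivAt_id' t).const_mul c).div_const 2).neg.congr_deriv (by ring)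
      exact this.exp.congr_deriv (by ring)
    have hdg : ∀ t, HasDerivAt (g (m + 2))
        ((m + 2) * c / 2 * (g (m + 1) t - g (m + 2) t)) t := fun t => by
      refine ((((hdq t).const_add 1).pow (m + 2)).add
        (((hdq t).const_sub 1).pow (m + 2))).congr_deriv ?_
      simp only [hg, Nat.add_succ_sub_one]
      push_cast
      ring
    have hdf : ∀ t, HasDerivAt f
        (∑ S : V → Bool, -(crossings a b S : ℝ) * Real.exp (-(t * crossings a b S))) t := fun t => by
      refine HasDerivAt.fun_sum fun S _ => ?_
      have : HasDerivAt (fun t : ℝ => -(t * crossings a b S)) (-(crossings a b S : ℝ)) t :=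
        ((hasDerivAt_id' t).mul_const (crossings a b S : ℝ)).neg.congr_deriv (by ring)
      exact this.exp.congr_deriv (by ring)
    have hcontract : ∀ t, 0 ≤ t → (N.card : ℝ) * f t +
        ∑ S : V → Bool, -(crossings a b S : ℝ) * Real.exp (-(t * crossings a b S)) ≤
          N.card * g (m + 1) t := fun t ht => by
      have hswap : (N.card : ℝ) * f t +
          ∑ S : V → Bool, -(crossings a b S : ℝ) * Real.exp (-(t * crossings a b S)) =
          ∑ i ∈ N, ∑ S : V → Bool with S (a i) = S (b i), Real.exp (-(t * crossings a b S)) := by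
        simp only [hf, Finset.mul_sum, ← Finset.sum_add_distrib, Finset.sum_filter]
        rw [Finset.sum_comm]
        refine Finset.sum_congr rfl fun S _ => ?_
        rw [← Finset.sum_filter, Finset.sum_const, nsmul_eq_mul,
          ← card_filter_eq_add_crossings a b S]
        push_cast
        ring
      rw [hswap, ← nsmul_eq_mul]
      refine Finset.sum_le_card_nsmul _ _ _ fun i hi => ?_
      have hi : a i ≠ b i := by simpa [hN] using hi
      rw [sum_filter_eq_sum_mergeInto hi]
      refine ih {v : V // v ≠ b i} (mergeInto hi ∘ a) (mergeInto hi ∘ b) ?_ ?_ t ht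
      · rw [Fintype.card_subtype_compl, Fintype.card_subtype_eq, hV]
        rfl
      · rintro T ⟨u, v, huv⟩
        exact hcut (T ∘ mergeInto hi) ⟨u, v, by simpa [mergeInto_coe] using huv⟩
    have hedges : (m + 2) * c / 2 ≤ (N.card : ℝ) := by
      have h1 : ∑ _v : V, c ≤ ∑ v, (crossings a b (fun u => decide (u = v)) : ℝ) := by
        refine Finset.sum_le_sum fun v _ => hcut _ ?_
        have : Nontrivial V := Fintype.one_lt_card_iff_nontrivial.1 (by omega)
        obtain ⟨u, hu⟩ := exists_ne v
        exact ⟨u, v, by simp [hu]⟩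
      rw [← Nat.cast_sum, sum_crossings_singleton, Finset.sum_const, Finset.card_univ, hV,
        nsmul_eq_mul] at h1
      push_cast at h1
      linarith
    have hgstep : ∀ t, g (m + 1) t - g (m + 2) t ≤ 0 := fun t => by
      have h1 : g (m + 1) t - g (m + 2) t = -(q t * ((1 + q t) ^ (m + 1) - (1 - q t) ^ (m + 1))) := by
        simp only [hg]
        ring
      have h2 : (1 - q t) ^ (m + 1) ≤ (1 + q t) ^ (m + 1) := by
        refine (le_abs_self _).trans ?_
        rw [abs_pow]
        refine pow_le_pow_left₀ (abs_nonneg _) ?_ _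
        rw [abs_le]
        constructor <;> linarith [hq0 t]
      rw [h1]
      exact neg_nonpos.2 (mul_nonneg (hq0 t).le (sub_nonneg.2 h2))
    have hdF : ∀ t, HasDerivAt (fun t => Real.exp (N.card * t) * (f t - g (m + 2) t)) _ t :=
      fun t => (((hasDerivAt_id t).const_mul (N.card : ℝ)).exp).mul ((hdf t).sub (hdg t))
    have hanti : AntitoneOn (fun t => Real.exp (N.card * t) * (f t - g (m + 2) t))
        (Set.Ici 0) := by
      refine antitoneOn_of_hasDerivWithinAt_nonpos (convex_Ici 0)
        (fun t _ => (hdF t).continuousAt.continuousWithinAt)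
        (fun t _ => (hdF t).hasDerivWithinAt) fun t ht => ?_
      rw [interior_Ici, Set.mem_Ioi] at ht
      have h1 := hcontract t ht.le
      have h2 := mul_le_mul_of_nonpos_right hedges (hgstep t)
      have h3 := Real.exp_pos (N.card * t)
      simp only [id, mul_one]
      nlinarith
    intro t ht
    have h0 := hanti Set.self_mem_Ici ht ht
    have hzero : f 0 - g (m + 2) 0 = 0 := by
      simp only [hf, hg, hq]
      simp [hV]
      norm_num
    simp only [hzero, mul_zero] at h0
    have := nonpos_of_mul_nonpos_right h0 (Real.exp_pos _)
    exact sub_nonpos.1 this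

end Contraction

section Chernoff

variable {ι : Type}

theorem measurable_card_filter_le (D : Finset ι) (p : ℝ) :
    Measurable fun ω : ι → ℝ => ((D.filter fun e => ω e ≤ p).card : ℝ) := by
  simp only [Finset.card_filter, Nat.cast_sum]
  refine Finset.measurable_sum _ fun e _ => ?_
  simp only [Nat.cast_ite, Nat.cast_one, Nat.cast_zero]
  exact Measurable.ite (measurableSet_le (measurable_pi_apply e) measurable_const)
    measurable_const measurable_const

variable [Fintype ι]

instance isProbabilityMeasure_restrict_Icc :
    IsProbabilityMeasure ((volume : Measure ℝ).restrict (Set.Icc 0 1)) :=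
  ⟨by simp⟩

theorem integrable_exp_card_filter_le (D : Finset ι) (p t : ℝ) :
    Integrable (fun ω : ι → ℝ => Real.exp (t * (D.filter fun e => ω e ≤ p).card))
      (Measure.pi fun _ => volume.restrict (Set.Icc 0 1)) := by
  refine Integrable.of_bound (C := Real.exp (|t| * D.card))
    ((measurable_card_filter_le D p).const_mul t).exp.aestronglyMeasurable
    (Filter.Eventually.of_forall fun ω => ?_)
  rw [Real.norm_eq_abs, Real.abs_exp, Real.exp_le_exp]
  exact mul_le_mul (le_abs_self t) (by exact_mod_cast Finset.card_filter_le _ _)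
    (Nat.cast_nonneg _) (abs_nonneg _)

theorem integral_ite_le_Icc {p : ℝ} (hp0 : 0 ≤ p) (hp1 : p ≤ 1) (y : ℝ) :
    ∫ x in Set.Icc (0 : ℝ) 1, (if x ≤ p then y else 1) = 1 + p * (y - 1) := by
  have h1 : ∀ x : ℝ, (if x ≤ p then y else 1) =
      1 + (Set.Iic p).indicator (fun _ => y - 1) x := fun x => by
    by_cases hx : x ≤ p <;> simp [Set.indicator, hx]
  simp_rw [h1]
  rw [integral_add (integrable_const _) ((integrable_const _).indicator measurableSet_Iic),
    integral_indicator measurableSet_Iic, Measure.restrict_restrict measurableSet_Iic]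
  have h2 : Set.Iic p ∩ Set.Icc 0 1 = Set.Icc 0 p := by
    ext x
    simp only [Set.mem_inter_iff, Set.mem_Iic, Set.mem_Icc]
    constructor
    · rintro ⟨h, h', _⟩
      exact ⟨h', h⟩
    · rintro ⟨h, h'⟩
      exact ⟨h', h, h'.trans hp1⟩
  rw [h2]
  simp [hp0]

/-- The moment generating function of the number of labels in `D` that are at most `p`. -/
theorem mgf_card_filter_le (D : Finset ι) {p : ℝ} (hp0 : 0 ≤ p) (hp1 : p ≤ 1) (t : ℝ) :
    ProbabilityTheory.mgf (fun ω : ι → ℝ => ((D.filter fun e => ω e ≤ p).card : ℝ))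
      (Measure.pi fun _ => volume.restrict (Set.Icc 0 1)) t =
      (1 + p * (Real.exp t - 1)) ^ D.card := by
  classical
  have h : ∀ ω : ι → ℝ, Real.exp (t * (D.filter fun e => ω e ≤ p).card) =
      ∏ e, if e ∈ D then (if ω e ≤ p then Real.exp t else 1) else 1 := fun ω => by
    simp only [← Finset.prod_filter, Finset.prod_const, Finset.filter_mem_eq_inter,
      Finset.univ_inter]
    rw [mul_comm, Real.exp_nat_mul]
  simp only [ProbabilityTheory.mgf, h]
  rw [integral_fintype_prod_eq_prod
    fun e x => if e ∈ D then (if x ≤ p then Real.exp t else 1) else 1]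
  have h2 : ∀ e, ∫ x in Set.Icc (0 : ℝ) 1,
      (if e ∈ D then (if x ≤ p then Real.exp t else 1) else 1) =
      if e ∈ D then 1 + p * (Real.exp t - 1) else 1 := fun e => by
    by_cases he : e ∈ D
    · simp only [he, if_true, integral_ite_le_Icc hp0 hp1]
    · simp [he]
  simp only [h2, ← Finset.prod_filter, Finset.prod_const, Finset.filter_mem_eq_inter,
    Finset.univ_inter]

theorem mgf_card_filter_le_le_exp (D : Finset ι) {p : ℝ} (hp0 : 0 ≤ p) (hp1 : p ≤ 1) (t : ℝ) :
    ProbabilityTheory.mgf (fun ω : ι → ℝ => ((D.filter fun e => ω e ≤ p).card : ℝ))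
      (Measure.pi fun _ => volume.restrict (Set.Icc 0 1)) t ≤
      Real.exp (p * D.card * (Real.exp t - 1)) := by
  rw [mgf_card_filter_le D hp0 hp1]
  have h1 : 1 + p * (Real.exp t - 1) ≤ Real.exp (p * (Real.exp t - 1)) := by
    rw [add_comm]
    exact Real.add_one_le_exp _
  have h0 : 0 ≤ 1 + p * (Real.exp t - 1) := by nlinarith [Real.exp_pos t]
  refine (pow_le_pow_left₀ h0 h1 _).trans_eq ?_
  rw [← Real.exp_nat_mul]
  ring_nf

/-- The multiplicative Chernoff bound for the lower tail. -/
theorem measureReal_card_filter_le_le (D : Finset ι) {p ε : ℝ} (hp0 : 0 ≤ p) (hp1 : p ≤ 1)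
    (hε : 0 ≤ ε) :
    (Measure.pi fun _ : ι => (volume : Measure ℝ).restrict (Set.Icc 0 1)).real
      {ω | ((D.filter fun e => ω e ≤ p).card : ℝ) ≤ (1 - ε) * (p * D.card)} ≤
      Real.exp (-(ε ^ 2 * p / 2 * D.card)) := by
  refine (ProbabilityTheory.measure_le_le_exp_mul_mgf (t := -ε) _ (neg_nonpos.2 hε)
    (integrable_exp_card_filter_le D p _)).trans ?_
  refine (mul_le_mul_of_nonneg_left (mgf_card_filter_le_le_exp D hp0 hp1 _)
    (Real.exp_pos _).le).trans ?_
  rw [← Real.exp_add, Real.exp_le_exp]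
  have h1 := Real.quadratic_le_exp_of_nonneg hε
  have h2 : Real.exp (-ε) ≤ 1 - ε + ε ^ 2 / 2 := by
    have h3 : Real.exp (-ε) * Real.exp ε = 1 := by rw [← Real.exp_add]; simp
    have h4 := mul_le_mul_of_nonneg_left h1 (by nlinarith [sq_nonneg (ε - 1)] :
      0 ≤ 1 - ε + ε ^ 2 / 2)
    refine le_of_mul_le_mul_right ?_ (Real.exp_pos ε)
    rw [h3]
    nlinarith [sq_nonneg (ε ^ 2)]
  have h5 : 0 ≤ p * D.card := by positivity
  nlinarith [mul_le_mul_of_nonneg_left h2 h5]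

/-- The multiplicative Chernoff bound for the upper tail. -/
theorem measureReal_le_card_filter_le (D : Finset ι) {p ε : ℝ} (hp0 : 0 ≤ p) (hp1 : p ≤ 1)
    (hε : 0 ≤ ε) (hε1 : ε ≤ 1) :
    (Measure.pi fun _ : ι => (volume : Measure ℝ).restrict (Set.Icc 0 1)).real
      {ω | (1 + ε) * (p * D.card) ≤ ((D.filter fun e => ω e ≤ p).card : ℝ)} ≤
      Real.exp (-(ε ^ 2 * p / 3 * D.card)) := by
  refine (ProbabilityTheory.measure_ge_le_exp_mul_mgf (t := Real.log (1 + ε)) _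
    (Real.log_nonneg (by linarith)) (integrable_exp_card_filter_le D p _)).trans ?_
  refine (mul_le_mul_of_nonneg_left (mgf_card_filter_le_le_exp D hp0 hp1 _)
    (Real.exp_pos _).le).trans ?_
  rw [← Real.exp_add, Real.exp_le_exp, Real.exp_log (by linarith)]
  have h1 := Real.le_log_one_add_of_nonneg hε
  have h2 : ε + ε ^ 2 / 3 ≤ (1 + ε) * Real.log (1 + ε) := by
    refine le_trans ?_ (mul_le_mul_of_nonneg_left h1 (by linarith))
    rw [mul_div_assoc', le_div_iff₀ (by linarith)]
    nlinarith [mul_nonneg (sq_nonneg ε) (sub_nonneg.2 hε1)]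
  have h5 : 0 ≤ p * D.card := by positivity
  nlinarith [mul_le_mul_of_nonneg_left h2 h5]

end Chernoff

section Cuts

variable {V : Type} [Fintype V]

/-- The edges of `G` joining vertices of different colours in the colouring `S`. -/
noncomputable def cutEdges (G : SimpleGraph V) (S : V → Bool) : Finset (Sym2 V) :=
  (Set.toFinite {e ∈ G.edgeSet | ∃ u ∈ {v | S v = true}, ∃ v ∈ {v | S v = true}ᶜ,
    e = s(u, v)}).toFinset

theorem card_cutEdges (G : SimpleGraph V) (S : V → Bool) :
    (cutEdges G S).card = cutSize G {v | S v = true} :=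
  (Set.ncard_eq_toFinset_card _ _).symm

theorem mk_mem_cutEdges {G : SimpleGraph V} {S : V → Bool} {u v : V} :
    s(u, v) ∈ cutEdges G S ↔ G.Adj u v ∧ S u ≠ S v := by
  simp only [cutEdges, Set.Finite.mem_toFinset, Set.mem_ofPred_eq, SimpleGraph.mem_edgeSet,
    Set.mem_compl_iff, Sym2.eq_iff]
  refine and_congr_right fun _ => ⟨?_, fun h => ?_⟩
  · rintro ⟨x, hx, y, hy, ⟨rfl, rfl⟩ | ⟨rfl, rfl⟩⟩ <;> simp_all
  · cases hu : S u
    · exact ⟨v, by simpa [hu] using h.symm, u, by simp [hu], by simp⟩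
    · exact ⟨u, hu, v, by simpa [hu] using h.symm, by simp⟩

theorem cutEdges_sampledGraph (G : SimpleGraph V) (ω : Sym2 V → ℝ) (p : ℝ) (S : V → Bool) :
    cutEdges (sampledGraph G ω p) S = (cutEdges G S).filter fun e => ω e ≤ p := by
  ext e
  induction e with
  | _ u v =>
    simp only [Finset.mem_filter, mk_mem_cutEdges, sampledGraph, SimpleGraph.fromEdgeSet_adj,
      Set.mem_ofPred_eq, SimpleGraph.mem_edgeSet]
    have := @SimpleGraph.Adj.ne _ G u v
    tauto

theorem edgeConn_le_card_cutEdges (G : SimpleGraph V) {S : V → Bool} (hS : ∃ u v, S u ≠ S v) :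
    edgeConn G ≤ (cutEdges G S).card := by
  refine Nat.sInf_le ⟨{v | S v = true}, ?_, ?_, (card_cutEdges G S).symm⟩
  · obtain ⟨u, v, h⟩ := hS
    cases hu : S u
    · exact ⟨v, by simpa [hu] using h.symm⟩
    · exact ⟨u, hu⟩
  · obtain ⟨u, v, h⟩ := hS
    cases hu : S u
    · exact ⟨u, by simp [hu]⟩
    · exact ⟨v, by simpa [hu] using h.symm⟩

theorem exists_card_cutEdges_eq_edgeConn (G : SimpleGraph V) (hV : 2 ≤ Fintype.card V) :
    ∃ S : V → Bool, (∃ u v, S u ≠ S v) ∧ (cutEdges G S).card = edgeConn G := by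
  classical
  have : Nontrivial V := Fintype.one_lt_card_iff_nontrivial.1 hV
  obtain ⟨x, y, hxy⟩ := exists_pair_ne V
  have hne : {c : ℕ | ∃ S : Set V, S.Nonempty ∧ Sᶜ.Nonempty ∧ cutSize G S = c}.Nonempty :=
    ⟨_, {x}, ⟨x, rfl⟩, ⟨y, hxy.symm⟩, rfl⟩
  obtain ⟨S, ⟨u, hu⟩, ⟨v, hv⟩, h⟩ := Nat.sInf_mem hne
  refine ⟨fun w => decide (w ∈ S), ⟨u, v, ?_⟩, ?_⟩
  · simp only [Set.mem_compl_iff] at hv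
    simp [hu, hv]
  · rw [card_cutEdges]
    simpa [edgeConn] using h

theorem crossings_out_eq_card_cutEdges (G : SimpleGraph V) [Fintype G.edgeSet] (S : V → Bool) :
    crossings (fun e : G.edgeSet => (Quot.out e.1).1) (fun e => (Quot.out e.1).2) S =
      (cutEdges G S).card := by
  refine Finset.card_bij (fun e _ => e.1) ?_ (fun _ _ _ _ h => Subtype.ext h) ?_
  · intro e he
    have hout : s((Quot.out e.1).1, (Quot.out e.1).2) = e.1 := Quot.out_eq e.1
    rw [← hout, mk_mem_cutEdges, ← SimpleGraph.mem_edgeSet, hout]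
    exact ⟨e.2, by simpa using he⟩
  · intro e he
    have hout : s((Quot.out e).1, (Quot.out e).2) = e := Quot.out_eq e
    rw [← hout, mk_mem_cutEdges, ← SimpleGraph.mem_edgeSet, hout] at he
    exact ⟨⟨e, he.1⟩, by simpa using he.2, rfl⟩

theorem one_add_pow_add_one_sub_pow_le {q : ℝ} (n : ℕ) (hq0 : 0 ≤ q) (hq1 : q ≤ 1)
    (hnq : n * q ≤ 1) : (1 + q) ^ n + (1 - q) ^ n ≤ 2 + 2 * (n * q) ^ 2 := by
  have hnn : 0 ≤ n * q := by positivity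
  have h1 : (1 + q) ^ n ≤ Real.exp (n * q) := by
    rw [Real.exp_nat_mul]
    exact pow_le_pow_left₀ (by linarith) (by linarith [Real.add_one_le_exp q]) _
  have h2 : (1 - q) ^ n ≤ Real.exp (-(n * q)) := by
    rw [← mul_neg, Real.exp_nat_mul]
    exact pow_le_pow_left₀ (by linarith) (by linarith [Real.add_one_le_exp (-q)]) _
  have h3 := (abs_le.1 (Real.abs_exp_sub_one_sub_id_le (x := n * q)
    (by rwa [abs_of_nonneg hnn]))).2
  have h4 := (abs_le.1 (Real.abs_exp_sub_one_sub_id_le (x := -(n * q))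
    (by rwa [abs_neg, abs_of_nonneg hnn]))).2
  rw [neg_sq] at h4
  linarith

/-- The exponential sum over the nontrivial cuts of `G`, in the range where it is small. -/
theorem sum_nontrivial_exp_neg_cutEdges_le [DecidableEq V] (G : SimpleGraph V)
    (hV : 2 ≤ Fintype.card V) {t : ℝ} (ht : 0 ≤ t) (htn : 6 * Real.log (Fintype.card V) ≤ t * edgeConn G) :
    ∑ S : V → Bool with ∃ u v, S u ≠ S v, Real.exp (-(t * (cutEdges G S).card)) ≤
      2 / (Fintype.card V : ℝ) ^ 4 := by
  have : Fintype G.edgeSet := Fintype.ofFinite _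
  obtain ⟨m, hm⟩ : ∃ m, Fintype.card V = m + 1 := ⟨Fintype.card V - 1, by omega⟩
  set n := Fintype.card V with hn
  have hn2 : (2 : ℝ) ≤ n := by exact_mod_cast hV
  have hn0 : (0 : ℝ) < n := by linarith
  have hne : Nonempty V := Fintype.card_pos_iff.1 (by omega)
  have hall := sum_exp_neg_crossings_le (c := edgeConn G) m V
    (fun e : G.edgeSet => (Quot.out e.1).1) (fun e => (Quot.out e.1).2) hm
    (fun S hS => by
      rw [crossings_out_eq_card_cutEdges]
      exact_mod_cast edgeConn_le_card_cutEdges G hS) t ht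
  simp only [crossings_out_eq_card_cutEdges] at hall
  rw [← hm] at hall
  set q := Real.exp (-(edgeConn G * t / 2)) with hq
  have hq0 : 0 < q := Real.exp_pos _
  have hqn : q ≤ 1 / (n : ℝ) ^ 3 := by
    rw [← Real.exp_log hn0, ← Real.exp_nat_mul, one_div, ← Real.exp_neg, Real.exp_le_exp]
    push_cast
    linarith
  have hnq : n * q ≤ 1 / (n : ℝ) ^ 2 := by
    refine (mul_le_mul_of_nonneg_left hqn hn0.le).trans_eq ?_
    field_simp
  have hnq1 : n * q ≤ 1 := hnq.trans (by rw [div_le_one (by positivity)]; nlinarith)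
  have hq1 : q ≤ 1 := by nlinarith
  have hbound := one_add_pow_add_one_sub_pow_le n hq0.le hq1 hnq1
  have hsq : (n * q) ^ 2 ≤ 1 / (n : ℝ) ^ 4 := by
    refine (pow_le_pow_left₀ (by positivity) hnq 2).trans_eq ?_
    rw [div_pow, ← pow_mul, one_pow]
  have hconst : (2 : ℝ) ≤
      ∑ S : V → Bool with ¬ ∃ u v, S u ≠ S v, Real.exp (-(t * (cutEdges G S).card)) := by
    have h0 : ∀ b : Bool, (cutEdges G fun _ => b).card = 0 := fun b => by
      rw [Finset.card_eq_zero, Finset.eq_empty_iff_forall_notMem]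
      intro e
      induction e with
      | _ u v => simp [mk_mem_cutEdges]
    have hne' : (fun _ : V => true) ≠ fun _ => false := fun h => by
      simpa using congrFun h hne.some
    refine le_trans (le_of_eq ?_) (Finset.sum_le_sum_of_subset_of_nonneg
      (s := {(fun _ : V => true), fun _ => false}) ?_ fun _ _ _ => (Real.exp_pos _).le)
    · rw [Finset.sum_pair hne', h0, h0]
      norm_num
    · intro S hS
      simp only [Finset.mem_insert, Finset.mem_singleton] at hS
      rcases hS with rfl | rfl <;> simp
  have hsplit := Finset.sum_filter_add_sum_filter_not Finset.univ
    (fun S : V → Bool => ∃ u v, S u ≠ S v) fun S => Real.exp (-(t * (cutEdges G S).card))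
  have : 2 / (n : ℝ) ^ 4 = 2 * (1 / (n : ℝ) ^ 4) := by ring
  rw [this]
  linarith

end Cuts

section Sampling

variable {V : Type} [Fintype V] [DecidableEq V]

instance isProbabilityMeasure_edgeLabelMeasure : IsProbabilityMeasure (edgeLabelMeasure V) := by
  unfold edgeLabelMeasure
  infer_instance

theorem ae_edgeConn_sampledGraph_eq (G : SimpleGraph V) {p : ℝ} (hp : 1 ≤ p) :
    ∀ᵐ ω ∂edgeLabelMeasure V, edgeConn (sampledGraph G ω p) = edgeConn G := by
  have h : ∀ᵐ ω ∂edgeLabelMeasure V, ∀ e, ω e ∈ Set.Icc (0 : ℝ) 1 :=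
    ae_all_iff.2 fun e => (Measure.tendsto_eval_ae_ae (i := e)).eventually
      (ae_restrict_mem measurableSet_Icc)
  filter_upwards [h] with ω hω
  have : sampledGraph G ω p = G := by
    ext u v
    simp only [sampledGraph, SimpleGraph.fromEdgeSet_adj, Set.mem_ofPred_eq,
      SimpleGraph.mem_edgeSet]
    exact ⟨fun h => h.1.1, fun h => ⟨⟨h, (hω _).2.trans hp⟩, h.ne⟩⟩
  rw [this]

theorem measureReal_compl_edgeConn_approx_le (G : SimpleGraph V) {ε p : ℝ}
    (hV : 2 ≤ Fintype.card V) (hε : 0 < ε) (hε1 : ε < 1) (hp : 0 < p) (hp1 : p ≤ 1)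
    (hpn : 12 * Real.log (Fintype.card V) ≤ ε ^ 2 * p * edgeConn G) :
    (edgeLabelMeasure V).real {ω : Sym2 V → ℝ |
      (1 - ε) * p * edgeConn G ≤ (edgeConn (sampledGraph G ω p) : ℝ) ∧
      (edgeConn (sampledGraph G ω p) : ℝ) ≤ (1 + ε) * p * edgeConn G}ᶜ ≤
      3 / (Fintype.card V : ℝ) ^ 4 := by
  obtain ⟨S₀, hS₀, hmin⟩ := exists_card_cutEdges_eq_edgeConn G hV
  set low : (V → Bool) → Set (Sym2 V → ℝ) := fun S =>
    {ω | (((cutEdges G S).filter fun e => ω e ≤ p).card : ℝ) ≤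
      (1 - ε) * (p * (cutEdges G S).card)} with hlow
  set high : Set (Sym2 V → ℝ) :=
    {ω | (1 + ε) * (p * (cutEdges G S₀).card) ≤
      (((cutEdges G S₀).filter fun e => ω e ≤ p).card : ℝ)} with hhigh
  have hsub : {ω : Sym2 V → ℝ |
      (1 - ε) * p * edgeConn G ≤ (edgeConn (sampledGraph G ω p) : ℝ) ∧
      (edgeConn (sampledGraph G ω p) : ℝ) ≤ (1 + ε) * p * edgeConn G}ᶜ ⊆
      (⋃ S ∈ Finset.univ.filter fun S : V → Bool => ∃ u v, S u ≠ S v, low S) ∪ high := by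
    intro ω hω
    rw [Set.mem_compl_iff, Set.mem_ofPred_eq, not_and_or, not_le, not_le] at hω
    rcases hω with hω | hω
    · left
      obtain ⟨S, hS, hSmin⟩ := exists_card_cutEdges_eq_edgeConn (sampledGraph G ω p) hV
      have hle : (edgeConn G : ℝ) ≤ (cutEdges G S).card := by
        exact_mod_cast edgeConn_le_card_cutEdges G hS
      simp only [Set.mem_iUnion, Finset.mem_filter, Finset.mem_univ, true_and]
      refine ⟨S, hS, ?_⟩
      rw [hlow, Set.mem_ofPred_eq, ← cutEdges_sampledGraph, hSmin, ← mul_assoc]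
      exact hω.le.trans (mul_le_mul_of_nonneg_left hle
        (mul_nonneg (by linarith) hp.le))
    · right
      have hle : (edgeConn (sampledGraph G ω p) : ℝ) ≤
          (cutEdges (sampledGraph G ω p) S₀).card := by
        exact_mod_cast edgeConn_le_card_cutEdges _ hS₀
      rw [hhigh, Set.mem_ofPred_eq, ← cutEdges_sampledGraph, hmin, ← mul_assoc]
      exact hω.le.trans hle
  have hn0 : (0 : ℝ) < Fintype.card V := by
    exact_mod_cast (by omega : 0 < Fintype.card V)
  have hlows : ∑ S : V → Bool with ∃ u v, S u ≠ S v, (edgeLabelMeasure V).real (low S) ≤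
      2 / (Fintype.card V : ℝ) ^ 4 := by
    refine (Finset.sum_le_sum fun S _ =>
      measureReal_card_filter_le_le (cutEdges G S) hp.le hp1 hε.le).trans ?_
    exact sum_nontrivial_exp_neg_cutEdges_le G hV (t := ε ^ 2 * p / 2) (by positivity)
      (by linarith)
  have hhighs : (edgeLabelMeasure V).real high ≤ 1 / (Fintype.card V : ℝ) ^ 4 := by
    refine (measureReal_le_card_filter_le (cutEdges G S₀) hp.le hp1 hε.le hε1.le).trans ?_
    rw [← Real.exp_log hn0, ← Real.exp_nat_mul, one_div, ← Real.exp_neg, Real.exp_le_exp, hmin]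
    push_cast
    linarith
  calc _ ≤ _ := measureReal_mono hsub
    _ ≤ _ := measureReal_union_le _ _
    _ ≤ _ := add_le_add ((measureReal_biUnion_finset_le _ _).trans hlows) hhighs
    _ = _ := by ring

end Sampling

/-- There is a constant `C > 0` such that for every connected graph `G` on `n ≥ 2`
vertices, every `ε ∈ (0,1)`, `k = 48·log n/ε²`, and every `p > 0` with
`p ≥ k/(4·λ(G))`, with probability at least `1 - C/n⁴` the subgraph `G(p)` (consisting
of the edges of weight at most `p` under i.i.d. uniform `[0,1]` edge weights) satisfies
`(1-ε)·min(p,1)·λ(G) ≤ λ(G(p)) ≤ (1+ε)·min(p,1)·λ(G)`, so that `λ(G(p))/min(p,1)` is a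
`(1+O(ε))`-approximation to `λ(G)`. -/
theorem sampled_edgeConn_approx :
    ∃ C : ℝ, 0 < C ∧
      ∀ (V : Type) [Fintype V] [DecidableEq V] (G : SimpleGraph V) (ε p : ℝ),
        2 ≤ Fintype.card V → G.Connected → 0 < ε → ε < 1 → 0 < p →
        48 * Real.log (Fintype.card V) / ε ^ 2 / (4 * edgeConn G) ≤ p →
        1 - ENNReal.ofReal (C / (Fintype.card V : ℝ) ^ 4) ≤
          edgeLabelMeasure V {ω : Sym2 V → ℝ |
            (1 - ε) * min p 1 * edgeConn G ≤ (edgeConn (sampledGraph G ω p) : ℝ) ∧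
            (edgeConn (sampledGraph G ω p) : ℝ) ≤ (1 + ε) * min p 1 * edgeConn G} := by
  refine ⟨3, by norm_num, ?_⟩
  intro V _ _ G ε p hV hG hε hε1 hp hpk
  rcases le_total 1 p with hp1 | hp1
  · have hfull : edgeLabelMeasure V {ω : Sym2 V → ℝ |
        (1 - ε) * min p 1 * edgeConn G ≤ (edgeConn (sampledGraph G ω p) : ℝ) ∧
        (edgeConn (sampledGraph G ω p) : ℝ) ≤ (1 + ε) * min p 1 * edgeConn G} = 1 := by
      refine (measure_congr (Filter.eventuallyEq_univ.2 ?_)).trans measure_univ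
      filter_upwards [ae_edgeConn_sampledGraph_eq G hp1] with ω hω
      have hc : (0 : ℝ) ≤ edgeConn G := Nat.cast_nonneg _
      rw [hω, min_eq_right hp1]
      constructor <;> nlinarith
    rw [hfull]
    exact tsub_le_self
  · rw [min_eq_left hp1]
    have hc : 0 < edgeConn G := by
      obtain ⟨S, ⟨u, v, huv⟩, hS⟩ := exists_card_cutEdges_eq_edgeConn G hV
      obtain ⟨w⟩ := hG.preconnected u v
      obtain ⟨d, -, hd, hd'⟩ :=
        w.exists_boundary_dart {x | S x = S u} rfl fun h => huv (Eq.symm h)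
      rw [← hS, Finset.card_pos]
      refine ⟨s(d.fst, d.snd), mk_mem_cutEdges.2 ⟨d.adj, fun h => hd' ?_⟩⟩
      exact h.symm.trans hd
    have hc' : (0 : ℝ) < edgeConn G := by exact_mod_cast hc
    have hpn : 12 * Real.log (Fintype.card V) ≤ ε ^ 2 * p * edgeConn G := by
      rw [div_div, div_le_iff₀ (by positivity)] at hpk
      linarith
    have hbad := measureReal_compl_edgeConn_approx_le G hV hε hε1 hp hp1 hpn
    rw [tsub_le_iff_right, ← measure_univ (μ := edgeLabelMeasure V)]
    set A := {ω : Sym2 V → ℝ |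
      (1 - ε) * p * edgeConn G ≤ (edgeConn (sampledGraph G ω p) : ℝ) ∧
      (edgeConn (sampledGraph G ω p) : ℝ) ≤ (1 + ε) * p * edgeConn G}
    rw [← Set.union_compl_self A]
    refine (measure_union_le _ _).trans (add_le_add_right ?_ _)
    rw [← ofReal_measureReal]
    exact ENNReal.ofReal_le_ofReal hbad
end

section
/- Let G = (V,E) be an undirected graph whose edges carry pairwise distinct real weights w : E → ℝ. Let F_1, …, F_{k+1} be edge-disjoint forests such that, for each i, F_i is a minimum-weight maximal spanning forest of G \ (F_1 ∪ … ∪ F_{i−1}) with respect to w. For a real p, let G(p), F_1(p), …, F_{k+1}(p) denote the subgraphs consisting of those edges of G, F_1, …, F_{k+1} respectively that have weight at most p. Then F_1(p), …, F_{k+1}(p) is a maximal spanning forest decomposition of order k+1 of G(p); that is, for each i, F_i(p) is a maximal spanning forest of G(p) \ (F_1(p) ∪ … ∪ F_{i−1}(p)). -/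
/-- `F` is a maximal spanning forest of `H`: a subforest of `H` such that the endpoints
of every edge of `H` lie in the same component of `F`. -/
def IsMaxSpanningForest {V : Type*} (H F : SimpleGraph V) : Prop :=
  F ≤ H ∧ F.IsAcyclic ∧ ∀ u v : V, H.Adj u v → F.Reachable u v

/-- The total weight of the edges of `F` with respect to the edge weights `w`. -/
noncomputable def totalWeight {V : Type*} (w : Sym2 V → ℝ) (F : SimpleGraph V) : ℝ :=
  ∑ᶠ e ∈ F.edgeSet, w e

/-- `F` is a minimum-weight maximal spanning forest of `H` with respect to the edge
weights `w`: a maximal spanning forest of `H` whose total weight is minimum among all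
maximal spanning forests of `H`. -/
def IsMinWeightMaxSpanningForest {V : Type*} (w : Sym2 V → ℝ) (H F : SimpleGraph V) :
    Prop :=
  IsMaxSpanningForest H F ∧
    ∀ F' : SimpleGraph V, IsMaxSpanningForest H F' → totalWeight w F ≤ totalWeight w F'

/-- The subgraph of `G` consisting of the edges of weight at most `p`. -/
def levelSubgraph {V : Type*} (w : Sym2 V → ℝ) (G : SimpleGraph V) (p : ℝ) :
    SimpleGraph V :=
  SimpleGraph.fromEdgeSet {e ∈ G.edgeSet | w e ≤ p}

open SimpleGraph in
/-- Exchange property: replacing an edge of a maximal spanning forest `F` of `H`, lying on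
the `F`-path joining the endpoints of an edge of `H` outside `F`, by this latter edge gives
another maximal spanning forest. -/
theorem IsMaxSpanningForest.exchange {V : Type*} {H F : SimpleGraph V}
    (hF : IsMaxSpanningForest H F) {u v : V} (huv : H.Adj u v) (hnF : ¬ F.Adj u v)
    {P : F.Walk u v} (hP : P.IsPath) {e : Sym2 V} (he : e ∈ P.edges) :
    IsMaxSpanningForest H (F.deleteEdges {e} ⊔ edge u v) := by
  classical
  obtain ⟨hle, hac, hreach⟩ := hF
  refine ⟨sup_le ((deleteEdges_le _).trans hle) ?_, ?_, ?_⟩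
  · rwa [edge_le_iff, or_iff_right huv.ne]
  · refine (hac.anti (deleteEdges_le _)).sup_edge_of_not_reachable ?_
    rintro ⟨q⟩
    have hPq := congrArg Subtype.val <|
      (hac.subsingleton_path u v).elim ⟨P, hP⟩
        ⟨q.toPath.1.mapLe (deleteEdges_le _), q.toPath.2.mapLe _⟩
    rw [show P = _ from hPq, Walk.edges_mapLe_eq_edges] at he
    simpa using q.toPath.1.edges_subset_edgeSet he
  · have hcyc : ((P.mapLe (le_sup_left : F ≤ F ⊔ edge u v)).cons
        (show (F ⊔ edge u v).Adj v u by simp [edge_adj, huv.ne'])).IsCycle := by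
      rw [Walk.cons_isCycle_iff, Walk.edges_mapLe_eq_edges]
      refine ⟨hP.mapLe _, fun h ↦ hnF ?_⟩
      exact (P.edges_subset_edgeSet h : F.Adj v u).symm
    have hnb : ¬ (F ⊔ edge u v).IsBridge e := fun hb ↦
      hb.notMem_edges_of_isCycle hcyc (by simp [he])
    have hadj : ∀ x y, F.Adj x y → (F.deleteEdges {e} ⊔ edge u v).Reachable x y := by
      intro x y hxy
      by_cases hxe : s(x, y) = e
      · rw [← hxe, isBridge_iff, not_not] at hnb
        refine hnb.mono ?_
        rw [deleteEdges_sup, ← hxe]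
        exact sup_le_sup_left (deleteEdges_le _) _
      · exact Adj.reachable (Or.inl (by simp [hxy, hxe]))
    intro x y hxy
    obtain ⟨q⟩ := hreach x y hxy
    clear hxy
    induction q with
    | nil => rfl
    | cons h _ ih => exact (hadj _ _ h).trans ih

open SimpleGraph in
theorem totalWeight_exchange {V : Type*} [Finite V] (w : Sym2 V → ℝ) {F : SimpleGraph V}
    {u v : V} (huv : u ≠ v) (hnF : ¬ F.Adj u v) {e : Sym2 V} (he : e ∈ F.edgeSet) :
    totalWeight w (F.deleteEdges {e} ⊔ edge u v) + w e = totalWeight w F + w s(u, v) := by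
  have hn : s(u, v) ∉ F.edgeSet \ {e} := fun h ↦ hnF h.1
  have hE : (F.deleteEdges {e} ⊔ edge u v).edgeSet =
      insert s(u, v) (F.edgeSet \ {e}) := by
    rw [edgeSet_sup, edgeSet_deleteEdges, edgeSet_edge_of_ne huv, Set.union_singleton]
  have hF : F.edgeSet = insert e (F.edgeSet \ {e}) := by
    rw [Set.insert_sdiff_singleton, Set.insert_eq_of_mem he]
  have hsum : totalWeight w F = w e + ∑ᶠ f ∈ F.edgeSet \ {e}, w f := by
    rw [totalWeight]
    conv_lhs => rw [hF]
    exact finsum_mem_insert _ (fun h ↦ h.2 rfl) (Set.toFinite _)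
  rw [hsum, totalWeight, hE, finsum_mem_insert _ hn (Set.toFinite _)]
  ring

/-- Every edge on the path of a minimum-weight maximal spanning forest joining the endpoints
of an edge of the graph weighs at most as much as this edge. -/
theorem IsMinWeightMaxSpanningForest.le_of_mem_edges {V : Type*} [Finite V] {w : Sym2 V → ℝ}
    {H F : SimpleGraph V} (hF : IsMinWeightMaxSpanningForest w H F) {u v : V}
    (huv : H.Adj u v) (hnF : ¬ F.Adj u v) {P : F.Walk u v} (hP : P.IsPath) {e : Sym2 V}
    (he : e ∈ P.edges) : w e ≤ w s(u, v) := by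
  have h₁ := hF.2 _ (hF.1.exchange huv hnF hP he)
  have h₂ := totalWeight_exchange w huv.ne hnF (P.edges_subset_edgeSet he)
  linarith

theorem levelSubgraph_adj {V : Type*} {w : Sym2 V → ℝ} {G : SimpleGraph V} {p : ℝ} {u v : V} :
    (levelSubgraph w G p).Adj u v ↔ G.Adj u v ∧ w s(u, v) ≤ p := by
  simp only [levelSubgraph, SimpleGraph.fromEdgeSet_adj, Set.mem_ofPred_eq,
    SimpleGraph.mem_edgeSet, and_iff_left_iff_imp]
  exact fun h ↦ h.1.ne

theorem IsMinWeightMaxSpanningForest.levelSubgraph {V : Type*} [Finite V] {w : Sym2 V → ℝ}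
    {H F : SimpleGraph V} (hF : IsMinWeightMaxSpanningForest w H F) (p : ℝ) :
    IsMaxSpanningForest (levelSubgraph w H p) (levelSubgraph w F p) := by
  refine ⟨fun u v h ↦ ?_, hF.1.2.1.anti fun u v h ↦ (levelSubgraph_adj.1 h).1, ?_⟩
  · rw [levelSubgraph_adj] at h ⊢
    exact ⟨hF.1.1 h.1, h.2⟩
  · intro u v h
    have huv := levelSubgraph_adj.1 h
    by_cases hadj : F.Adj u v
    · exact (levelSubgraph_adj.2 ⟨hadj, huv.2⟩).reachable
    · obtain ⟨P, hP⟩ := (hF.1.2.2 u v huv.1).exists_isPath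
      refine ⟨P.transfer _ fun e he ↦ ?_⟩
      have hle := (hF.le_of_mem_edges huv.1 hadj hP he).trans huv.2
      have heF := P.edges_subset_edgeSet he
      induction e with
      | h x y => exact levelSubgraph_adj.2 ⟨heF, hle⟩

theorem levelSubgraph_sdiff_iSup {V ι : Type*} (w : Sym2 V → ℝ) (G : SimpleGraph V)
    (s : Finset ι) (F : ι → SimpleGraph V) (p : ℝ) :
    levelSubgraph w (G \ ⨆ j ∈ s, F j) p =
      levelSubgraph w G p \ ⨆ j ∈ s, levelSubgraph w (F j) p := by
  ext u v
  simp only [levelSubgraph_adj, SimpleGraph.sdiff_adj, SimpleGraph.iSup_adj]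
  grind

/-- Let `G` be a graph whose edges carry pairwise distinct weights `w`, and let
`F 1, …, F (k+1)` be edge-disjoint forests such that each `F i` is a minimum-weight
maximal spanning forest of `G \ (F 1 ∪ … ∪ F (i-1))`. For real `p`, let `G(p)`,
`F i (p)` denote the corresponding subgraphs of edges of weight at most `p`. Then
`F 1 (p), …, F (k+1) (p)` is a maximal spanning forest decomposition of order `k+1` of
`G(p)`: for each `i`, `F i (p)` is a maximal spanning forest of
`G(p) \ (F 1 (p) ∪ … ∪ F (i-1) (p))`. -/
theorem minWeightForests_levelSubgraph_msfd {V : Type*} [Fintype V]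
    (G : SimpleGraph V) (w : Sym2 V → ℝ)
    (hw : ∀ e ∈ G.edgeSet, ∀ f ∈ G.edgeSet, w e = w f → e = f)
    (k : ℕ) (F : ℕ → SimpleGraph V)
    (hdisj : ∀ i ∈ Finset.Icc 1 (k + 1), ∀ j ∈ Finset.Icc 1 (k + 1), i ≠ j →
      Disjoint (F i) (F j))
    (hmin : ∀ i ∈ Finset.Icc 1 (k + 1),
      IsMinWeightMaxSpanningForest w (G \ ⨆ j ∈ Finset.Icc 1 (i - 1), F j) (F i))
    (p : ℝ) :
    ∀ i ∈ Finset.Icc 1 (k + 1),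
      IsMaxSpanningForest
        (levelSubgraph w G p \ ⨆ j ∈ Finset.Icc 1 (i - 1), levelSubgraph w (F j) p)
        (levelSubgraph w (F i) p) := by
  intro i hi
  rw [← levelSubgraph_sdiff_iSup]
  exact (hmin i hi).levelSubgraph p
end
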